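/- Let k > 0, m,ℓ ≥ 0 integers, and fix y₁,y₂ > 0 with y₁ ≠ y₂. Define H(x₁,x₂) = (Γ(k+1/2)/(Γ(k)√π)) ∫_{−1}^{1} P_{m,ℓ}(X₁(x,y,u), X₂(x,y,u)) (1−u²)^{k−1} du. Then for all (x₁,x₂) with x₁,x₂ > 0 and x₁ ≠ x₂, (Λ_k H)(x₁,x₂) = e·H(x₁,x₂) with e = (m+ℓ)(m+ℓ+2k−1) + ℓ(ℓ−1). -/

import Mathlib

open Real

/-- Integral representation of the two-variable Jack polynomial `P_{(m+ℓ, ℓ)}`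
with parameter `k > 0`. -/
noncomputable def JackP (k : ℝ) (m ℓ : ℕ) (x₁ x₂ : ℝ) : ℝ :=
  (Real.Gamma (m + 2 * k) / ((2 : ℝ) ^ (2 * k - 1) * Real.Gamma k * Real.Gamma (m + k))) *
    ((x₁ * x₂) ^ ℓ *
      ∫ u in (-1 : ℝ)..1, ((x₁ + x₂) / 2 + u * (x₁ - x₂) / 2) ^ m * (1 - u ^ 2) ^ (k - 1))

/-- The Laplace–Beltrami-type operator `Λ_k`. -/
noncomputable def Lam (k : ℝ) (f : ℝ → ℝ → ℝ) (x₁ x₂ : ℝ) : ℝ :=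
  x₁ ^ 2 * deriv (deriv (fun s => f s x₂)) x₁ +
    x₂ ^ 2 * deriv (deriv (fun s => f x₁ s)) x₂ +
    2 * k * (x₁ ^ 2 / (x₁ - x₂) * deriv (fun s => f s x₂) x₁ +
      x₂ ^ 2 / (x₂ - x₁) * deriv (fun s => f x₁ s) x₂)

/-- The normalized modified Bessel function of the first kind,
`𝓘_ν(t) = Γ(ν+1) Σ_{m≥0} (t/2)^{2m}/(m! Γ(m+ν+1))`. -/
noncomputable def besselI (ν t : ℝ) : ℝ :=
  Real.Gamma (ν + 1) *
    ∑' m : ℕ, (t / 2) ^ (2 * m) / ((m.factorial : ℝ) * Real.Gamma (m + ν + 1))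

/-- `α(x, y, u) = ((x₁+x₂)(y₁+y₂) + (x₁−x₂)(y₁−y₂)u)/2`. -/
noncomputable def alph (x₁ x₂ y₁ y₂ u : ℝ) : ℝ :=
  ((x₁ + x₂) * (y₁ + y₂) + (x₁ - x₂) * (y₁ - y₂) * u) / 2

/-- `X₁(x, y, u) = (α + √(α² − 4x₁x₂y₁y₂))/2`. -/
noncomputable def X1 (x₁ x₂ y₁ y₂ u : ℝ) : ℝ :=
  (alph x₁ x₂ y₁ y₂ u +
    Real.sqrt ((alph x₁ x₂ y₁ y₂ u) ^ 2 - 4 * x₁ * x₂ * y₁ * y₂)) / 2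

/-- `X₂(x, y, u) = (α − √(α² − 4x₁x₂y₁y₂))/2`. -/
noncomputable def X2 (x₁ x₂ y₁ y₂ u : ℝ) : ℝ :=
  (alph x₁ x₂ y₁ y₂ u -
    Real.sqrt ((alph x₁ x₂ y₁ y₂ u) ^ 2 - 4 * x₁ * x₂ * y₁ * y₂)) / 2


lemma w_intble (k : ℝ) (hk : 0 < k) :
    IntervalIntegrable (fun u : ℝ => (1 - u ^ 2) ^ (k - 1)) MeasureTheory.volume (-1) 1 := by
  have h1 : IntervalIntegrable (fun u : ℝ => u ^ (k - 1)) MeasureTheory.volume 0 1 :=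
    intervalIntegral.intervalIntegrable_rpow' (by linarith)
  have h2 : IntervalIntegrable (fun u : ℝ => (1 - u) ^ (k - 1)) MeasureTheory.volume 0 1 := by
    have := (h1.comp_sub_left 1).symm
    simpa using this
  have h3 : IntervalIntegrable (fun u : ℝ => (1 - u ^ 2) ^ (k - 1)) MeasureTheory.volume 0 1 := by
    have hc : ContinuousOn (fun u : ℝ => (1 + u) ^ (k - 1)) (Set.uIcc 0 1) := by
      intro u hu
      rw [Set.uIcc_of_le (by norm_num)] at hu
      apply ContinuousAt.continuousWithinAt
      apply ContinuousAt.rpow_const (by fun_prop)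
      left; have := hu.1; linarith
    refine (h2.mul_continuousOn hc).congr ?_
    intro u hu
    rw [Set.uIoc_of_le (by norm_num)] at hu
    simp only
    rw [← Real.mul_rpow (by linarith [hu.2]) (by linarith [hu.1])]
    congr 1; ring
  have h4 : IntervalIntegrable (fun u : ℝ => (1 - u ^ 2) ^ (k - 1)) MeasureTheory.volume (-1) 0 := by
    have := (h3.comp_sub_left 0).symm
    simpa using this
  exact h4.trans h3

lemma total_deriv (k : ℝ) (hk : 0 < k) (q q' : ℝ → ℝ) (hq : ∀ u, HasDerivAt q (q' u) u)
    (hq' : Continuous q') :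
    ∫ u in (-1 : ℝ)..1, ((1 - u ^ 2) * q' u - 2 * k * u * q u) * (1 - u ^ 2) ^ (k - 1) = 0 := by
  have hqc : Continuous q := continuous_iff_continuousAt.2 fun u => (hq u).continuousAt
  have := intervalIntegral.integral_eq_sub_of_hasDerivAt_of_le (a := -1) (b := 1)
    (f := fun u : ℝ => (1 - u ^ 2) ^ k * q u)
    (f' := fun u : ℝ => ((1 - u ^ 2) * q' u - 2 * k * u * q u) * (1 - u ^ 2) ^ (k - 1))
    (by norm_num) ?_ ?_ ?_
  · rw [this]; simp [Real.zero_rpow hk.ne']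
  · apply Continuous.continuousOn
    apply Continuous.mul _ hqc
    exact Continuous.rpow_const (by fun_prop) (fun _ => Or.inr hk.le)
  · intro u hu
    have hpos : 0 < 1 - u ^ 2 := by nlinarith [hu.1, hu.2]
    have h1 : HasDerivAt (fun u : ℝ => 1 - u ^ 2) (-(2 * u)) u := by
      simpa using (hasDerivAt_pow 2 u).const_sub 1
    have h2 := (h1.rpow_const (p := k) (Or.inl hpos.ne')).mul (hq u)
    refine h2.congr_deriv ?_
    have : (1 - u ^ 2) ^ k = (1 - u ^ 2) ^ (k - 1) * (1 - u ^ 2) := by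
      rw [← Real.rpow_add_one hpos.ne']; congr 1; ring
    rw [this]; ring
  · exact (w_intble k hk).continuousOn_mul (by fun_prop)

lemma deriv_under (w : ℝ → ℝ) (hw : IntervalIntegrable w MeasureTheory.volume (-1) 1)
    (F F' : ℝ → ℝ → ℝ) (hF : ∀ t u, HasDerivAt (fun t => F t u) (F' t u) t)
    (hc : Continuous (fun z : ℝ × ℝ => F z.1 z.2))
    (hc' : Continuous (fun z : ℝ × ℝ => F' z.1 z.2)) (t : ℝ) :
    HasDerivAt (fun t => ∫ u in (-1 : ℝ)..1, F t u * w u) (∫ u in (-1 : ℝ)..1, F' t u * w u) t := by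
  obtain ⟨B, hB⟩ := (((isCompact_Icc (a := t - 1) (b := t + 1)).prod
    (isCompact_Icc (a := (-1 : ℝ)) (b := 1))).exists_bound_of_continuousOn hc'.continuousOn)
  have hcF : ∀ x, Continuous (F x) := fun x => hc.comp (by fun_prop : Continuous fun u : ℝ => (x, u))
  have hcF' : ∀ x, Continuous (F' x) := fun x => hc'.comp (by fun_prop : Continuous fun u : ℝ => (x, u))
  have hi : ∀ x, IntervalIntegrable (fun u => F x u * w u) MeasureTheory.volume (-1) 1 := fun x =>
    hw.continuousOn_mul (hcF x).continuousOn
  have hi' : ∀ x, IntervalIntegrable (fun u => F' x u * w u) MeasureTheory.volume (-1) 1 := fun x =>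
    hw.continuousOn_mul (hcF' x).continuousOn
  refine (intervalIntegral.hasDerivAt_integral_of_dominated_loc_of_deriv_le
    (F := fun x u => F x u * w u) (F' := fun x u => F' x u * w u)
    (s := Metric.ball t 1) (bound := fun u => B * |w u|)
    (Metric.ball_mem_nhds t one_pos) ?_ (hi t) ?_ ?_ ?_ ?_).2
  · exact Filter.Eventually.of_forall fun x => (hi x).def'.aestronglyMeasurable
  · exact (hi' t).def'.aestronglyMeasurable
  · refine Filter.Eventually.of_forall fun u hu x hx => ?_
    rw [Set.uIoc_of_le (by norm_num)] at hu
    rw [Metric.mem_ball, Real.dist_eq, abs_lt] at hx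
    rw [norm_mul, Real.norm_eq_abs (w u)]
    gcongr
    exact hB (x, u) ⟨⟨by linarith [hx.1], by linarith [hx.2]⟩, ⟨hu.1.le, hu.2⟩⟩
  · exact hw.abs.const_mul B
  · exact Filter.Eventually.of_forall fun u hu x hx => (hF x u).mul_const (w u)

noncomputable def Mom (k : ℝ) (i : ℕ) : ℝ := ∫ u in (-1 : ℝ)..1, u ^ i * (1 - u ^ 2) ^ (k - 1)

lemma Mom_odd (k : ℝ) (j : ℕ) : Mom k (2 * j + 1) = 0 := by
  have h := intervalIntegral.integral_comp_neg (a := -1) (b := 1)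
    (fun u : ℝ => u ^ (2 * j + 1) * (1 - u ^ 2) ^ (k - 1))
  have h2 : ∀ u : ℝ, (-u) ^ (2 * j + 1) = - u ^ (2 * j + 1) := fun u => Odd.neg_pow ⟨j, rfl⟩ u
  simp only [h2, neg_sq, neg_neg, neg_mul, intervalIntegral.integral_neg] at h
  unfold Mom
  linarith

lemma Mom_int (k : ℝ) (hk : 0 < k) (i : ℕ) :
    IntervalIntegrable (fun u : ℝ => u ^ i * (1 - u ^ 2) ^ (k - 1)) MeasureTheory.volume (-1) 1 :=
  (w_intble k hk).continuousOn_mul (by fun_prop)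

lemma Mom_rec (k : ℝ) (hk : 0 < k) (j : ℕ) :
    ((j : ℝ) + 1) * Mom k j = (j + 1 + 2 * k) * Mom k (j + 2) := by
  have h := total_deriv k hk (fun u => u ^ (j + 1)) (fun u => ((j : ℝ) + 1) * u ^ j)
    (fun u => by simpa using hasDerivAt_pow (j + 1) u) (by fun_prop)
  have e : ∀ u : ℝ, ((1 - u ^ 2) * (((j : ℝ) + 1) * u ^ j) - 2 * k * u * u ^ (j + 1)) *
      (1 - u ^ 2) ^ (k - 1) = ((j : ℝ) + 1) * (u ^ j * (1 - u ^ 2) ^ (k - 1)) -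
      (j + 1 + 2 * k) * (u ^ (j + 2) * (1 - u ^ 2) ^ (k - 1)) := fun u => by ring
  simp only [e] at h
  rw [intervalIntegral.integral_sub ((Mom_int k hk j).const_mul _)
    ((Mom_int k hk (j + 2)).const_mul _), intervalIntegral.integral_const_mul,
    intervalIntegral.integral_const_mul] at h
  unfold Mom; linarith

noncomputable def cc (k : ℝ) (m j : ℕ) : ℝ := (m.choose (2 * j) : ℝ) * Mom k (2 * j)

lemma cc_zero (k : ℝ) (m j : ℕ) (h : m < 2 * j) : cc k m j = 0 := by
  simp [cc, Nat.choose_eq_zero_of_lt h]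

lemma cc_rec (k : ℝ) (hk : 0 < k) (m j : ℕ) :
    cc k m (j + 1) * (((j : ℝ) + 1) * (2 * j + 1 + 2 * k)) =
      cc k m j * (((m : ℝ) - 2 * j) * (m - 2 * j - 1) / 2) := by
  rcases lt_or_ge m (2 * j + 2) with h | h
  · rw [cc_zero k m (j + 1) (by omega)]
    rcases lt_or_ge m (2 * j) with h' | h'
    · rw [cc_zero k m j h']; simp
    · have : m = 2 * j ∨ m = 2 * j + 1 := by omega
      rcases this with rfl | rfl <;> push_cast <;> ring
  · have h1 := Nat.choose_succ_right_eq m (2 * j)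
    have h2 := Nat.choose_succ_right_eq m (2 * j + 1)
    have h1' : (m.choose (2 * j + 1) : ℝ) * (2 * j + 1) = m.choose (2 * j) * (m - 2 * j) := by
      have := congrArg (Nat.cast (R := ℝ)) h1
      rw [Nat.cast_mul, Nat.cast_mul, Nat.cast_sub (by omega)] at this
      push_cast at this; exact this
    have h2' : (m.choose (2 * j + 2) : ℝ) * (2 * j + 2) = m.choose (2 * j + 1) * (m - 2 * j - 1) := by
      have := congrArg (Nat.cast (R := ℝ)) h2
      rw [Nat.cast_mul, Nat.cast_mul, Nat.cast_sub (by omega)] at this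
      push_cast at this; linarith
    have h3 := Mom_rec k hk (2 * j)
    push_cast at h3
    unfold cc
    rw [show 2 * (j + 1) = 2 * j + 2 by ring]
    have hp : (2 * (j : ℝ) + 1) ≠ 0 := by positivity
    apply mul_left_cancel₀ hp
    linear_combination (m.choose (2 * j + 2) : ℝ) * (j + 1) * (2 * j + 1) * (-h3) +
      (2 * j + 1) ^ 2 * Mom k (2 * j) / 2 * h2' +
      (2 * j + 1) * (m - 2 * j - 1) * Mom k (2 * j) / 2 * h1'

lemma sum_even (h : ℕ → ℝ) (hodd : ∀ j, h (2 * j + 1) = 0) (n : ℕ) :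
    ∑ i ∈ Finset.range (2 * n), h i = ∑ j ∈ Finset.range n, h (2 * j) := by
  induction n with
  | zero => simp
  | succ n ih =>
    rw [show 2 * (n + 1) = 2 * n + 1 + 1 by ring, Finset.sum_range_succ, Finset.sum_range_succ, ih,
      Finset.sum_range_succ, hodd, add_zero]

lemma jack_int (k : ℝ) (hk : 0 < k) (m : ℕ) (x₁ x₂ : ℝ) :
    ∫ u in (-1 : ℝ)..1, ((x₁ + x₂) / 2 + u * (x₁ - x₂) / 2) ^ m * (1 - u ^ 2) ^ (k - 1) =
      (1 / 2) ^ m * ∑ j ∈ Finset.range (m + 1), cc k m j *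
        ((x₁ + x₂) ^ (m - 2 * j) * ((x₁ + x₂) ^ 2 - 4 * (x₁ * x₂)) ^ j) := by
  have e : ∀ u : ℝ, ((x₁ + x₂) / 2 + u * (x₁ - x₂) / 2) ^ m * (1 - u ^ 2) ^ (k - 1) =
      ∑ i ∈ Finset.range (m + 1), ((1 / 2) ^ m * (x₁ - x₂) ^ i * (x₁ + x₂) ^ (m - i) * m.choose i) *
        (u ^ i * (1 - u ^ 2) ^ (k - 1)) := by
    intro u
    rw [show (x₁ + x₂) / 2 + u * (x₁ - x₂) / 2 = (1 / 2) * (u * (x₁ - x₂) + (x₁ + x₂)) by ring,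
      mul_pow, add_pow, Finset.mul_sum, Finset.sum_mul]
    refine Finset.sum_congr rfl fun i _ => ?_
    rw [mul_pow]; ring
  simp only [e]
  rw [intervalIntegral.integral_finsetSum (fun i _ => (Mom_int k hk i).const_mul _)]
  simp only [intervalIntegral.integral_const_mul]
  set h : ℕ → ℝ := fun i => ((1 / 2) ^ m * (x₁ - x₂) ^ i * (x₁ + x₂) ^ (m - i) * m.choose i) *
    Mom k i with hh
  have h1 : ∑ i ∈ Finset.range (m + 1), h i = ∑ i ∈ Finset.range (2 * (m + 1)), h i := by
    apply Finset.sum_subset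
    · intro i hi; simp at hi ⊢; omega
    · intro i _ hi
      simp at hi
      simp [hh, Nat.choose_eq_zero_of_lt (show m < i by omega)]
  change ∑ i ∈ Finset.range (m + 1), h i = _
  rw [h1, sum_even h (fun j => by simp [hh, Mom_odd]), Finset.mul_sum]
  refine Finset.sum_congr rfl fun j _ => ?_
  simp only [hh, cc]
  rw [pow_mul (x₁ - x₂), show (x₁ + x₂) ^ 2 - 4 * (x₁ * x₂) = (x₁ - x₂) ^ 2 by ring]
  ring
open MvPolynomial in
noncomputable def Dop (k : ℝ) (g : MvPolynomial (Fin 2) ℝ) : MvPolynomial (Fin 2) ℝ :=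
  (X 0 ^ 2 - 2 * X 1) * pderiv 0 (pderiv 0 g) + 2 * X 1 * X 0 * pderiv 1 (pderiv 0 g)
    + 2 * X 1 ^ 2 * pderiv 1 (pderiv 1 g) + C (2 * k) * (X 0 * pderiv 0 g + X 1 * pderiv 1 g)

noncomputable def EE (a j : ℕ) : MvPolynomial (Fin 2) ℝ :=
  MvPolynomial.X 0 ^ a * (MvPolynomial.X 0 ^ 2 - 4 * MvPolynomial.X 1) ^ j

set_option linter.unusedSimpArgs false
section
open MvPolynomial

lemma p01 : pderiv (0 : Fin 2) (X 1 : MvPolynomial (Fin 2) ℝ) = 0 := pderiv_X_of_ne (by decide)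
lemma p10 : pderiv (1 : Fin 2) (X 0 : MvPolynomial (Fin 2) ℝ) = 0 := pderiv_X_of_ne (by decide)
lemma c4 : (C (4 : ℝ) : MvPolynomial (Fin 2) ℝ) = 4 := map_ofNat C 4
lemma c2 : (C (2 : ℝ) : MvPolynomial (Fin 2) ℝ) = 2 := map_ofNat C 2
lemma p4 (i : Fin 2) : pderiv i (4 : MvPolynomial (Fin 2) ℝ) = 0 := by
  rw [← c4]; simp

lemma ds_EE (a j : ℕ) : pderiv 0 (EE a j) =
    C (a : ℝ) * EE (a - 1) j + C (2 * j : ℝ) * EE (a + 1) (j - 1) := by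
  unfold EE
  simp [pderiv_mul, pderiv_pow, p01, p4, c2, c4]
  ring

lemma dp_EE (a j : ℕ) : pderiv 1 (EE a j) = C (-4 * j : ℝ) * EE a (j - 1) := by
  unfold EE
  simp [pderiv_mul, pderiv_pow, p10, p4, c2, c4]
  ring

lemma dC (i : Fin 2) (c : ℝ) (g : MvPolynomial (Fin 2) ℝ) :
    pderiv i (C c * g) = C c * pderiv i g := by simp [pderiv_mul]

lemma Dop_EE (k : ℝ) (a j : ℕ) : Dop k (EE a j) =
    C ((a : ℝ) * (a - 1) / 2 + 2 * j * (j - 1) + 4 * a * j + (1 + 2 * k) * j + 2 * k * a) * EE a j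
    + C ((a : ℝ) * (a - 1) / 2) * EE (a - 2) (j + 1)
    + C ((j : ℝ) * (2 * j - 1 + 2 * k)) * EE (a + 2) (j - 1) := by
  unfold Dop
  simp only [ds_EE, dp_EE, dC, map_add]
  unfold EE
  apply MvPolynomial.funext
  intro v
  simp only [map_add, map_mul, map_sub, map_pow, eval_C, eval_X, map_ofNat]
  generalize v 0 = s
  generalize v 1 = p
  rcases a with _ | _ | a <;> rcases j with _ | _ | j <;>
    simp only [Nat.cast_zero, Nat.cast_add, Nat.cast_one, zero_add, Nat.add_sub_cancel, 
      Nat.zero_sub, Nat.sub_self, Nat.reduceSub, Nat.reduceAdd, Nat.add_sub_cancel,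
      show ∀ a, a + 1 + 1 - 2 = a by omega] <;> ring

lemma euler_EE (a j : ℕ) : X 0 * pderiv 0 (EE a j) + 2 * X 1 * pderiv 1 (EE a j) =
    C ((a : ℝ) + 2 * j) * EE a j := by
  simp only [ds_EE, dp_EE]
  unfold EE
  apply MvPolynomial.funext
  intro v
  simp only [map_add, map_mul, map_sub, map_pow, eval_C, eval_X, map_ofNat]
  generalize v 0 = s
  generalize v 1 = p
  rcases a with _ | a <;> rcases j with _ | j <;>
    simp only [Nat.cast_zero, Nat.cast_add, Nat.cast_one, zero_add, Nat.add_sub_cancel, 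
      Nat.zero_sub] <;> ring

lemma Dop_add (k : ℝ) (f g : MvPolynomial (Fin 2) ℝ) : Dop k (f + g) = Dop k f + Dop k g := by
  unfold Dop; simp only [map_add]; ring

lemma Dop_sum (k : ℝ) (n : ℕ) (f : ℕ → MvPolynomial (Fin 2) ℝ) :
    Dop k (∑ j ∈ Finset.range n, f j) = ∑ j ∈ Finset.range n, Dop k (f j) := by
  induction n with
  | zero => simp [Dop]
  | succ n ih => rw [Finset.sum_range_succ, Dop_add, ih, Finset.sum_range_succ]

lemma Dop_C (k c : ℝ) (g : MvPolynomial (Fin 2) ℝ) : Dop k (C c * g) = C c * Dop k g := by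
  unfold Dop; simp only [dC]; ring

lemma Dop_G (k : ℝ) (m : ℕ) (c : ℕ → ℝ) (hc0 : ∀ j, m < 2 * j → c j = 0)
    (hc : ∀ j, c (j + 1) * (((j : ℝ) + 1) * (2 * j + 1 + 2 * k)) =
      c j * (((m : ℝ) - 2 * j) * (m - 2 * j - 1) / 2)) :
    Dop k (∑ j ∈ Finset.range (m + 1), C (c j) * EE (m - 2 * j) j) =
      C ((m : ℝ) * (m - 1 + 2 * k)) * ∑ j ∈ Finset.range (m + 1), C (c j) * EE (m - 2 * j) j := by
  rw [Dop_sum, Finset.mul_sum, ← sub_eq_zero, ← Finset.sum_sub_distrib]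
  set U : ℕ → MvPolynomial (Fin 2) ℝ := fun j => C (c j * (j * (2 * j - 1 + 2 * k))) *
    (EE (m - 2 * j) j - EE (m - 2 * (j - 1)) (j - 1)) with hU
  have key : ∀ j, Dop k (C (c j) * EE (m - 2 * j) j) -
      C ((m : ℝ) * (m - 1 + 2 * k)) * (C (c j) * EE (m - 2 * j) j) = U (j + 1) - U j := by
    intro j
    have hU1 : U (j + 1) = C (c j * (((m : ℝ) - 2 * j) * (m - 2 * j - 1) / 2)) *
        (EE (m - 2 * j - 2) (j + 1) - EE (m - 2 * j) j) := by
      rw [← hc]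
      simp only [hU, Nat.add_sub_cancel, Nat.cast_add, Nat.cast_one]
      rw [show m - 2 * (j + 1) = m - 2 * j - 2 by omega,
        show (2 * ((j : ℝ) + 1) - 1 + 2 * k) = 2 * j + 1 + 2 * k by ring]
    rw [hU1]
    rcases lt_or_ge m (2 * j) with h | h
    · simp [hU, hc0 j h, Dop]
    · rw [Dop_C, Dop_EE]
      simp only [hU]
      rw [Nat.cast_sub h]
      have hlow : C ((j : ℝ) * (2 * j - 1 + 2 * k)) * EE (m - 2 * j + 2) (j - 1) =
          C ((j : ℝ) * (2 * j - 1 + 2 * k)) * EE (m - 2 * (j - 1)) (j - 1) := by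
        rcases j with _ | j
        · simp
        · rw [show m - 2 * (j + 1) + 2 = m - 2 * (j + 1 - 1) by omega]
      rw [hlow]
      generalize EE (m - 2 * j) j = e1
      generalize EE (m - 2 * j - 2) (j + 1) = e2
      generalize EE (m - 2 * (j - 1)) (j - 1) = e3
      apply MvPolynomial.funext
      intro v
      simp only [map_add, map_mul, map_sub, eval_C]
      push_cast
      ring
  rw [Finset.sum_congr rfl fun j _ => key j, Finset.sum_range_sub]
  simp [hU, hc0 (m + 1) (by omega)]

lemma euler_G (m : ℕ) (c : ℕ → ℝ) (hc0 : ∀ j, m < 2 * j → c j = 0) :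
    X 0 * pderiv 0 (∑ j ∈ Finset.range (m + 1), C (c j) * EE (m - 2 * j) j) +
      2 * X 1 * pderiv 1 (∑ j ∈ Finset.range (m + 1), C (c j) * EE (m - 2 * j) j) =
      C (m : ℝ) * ∑ j ∈ Finset.range (m + 1), C (c j) * EE (m - 2 * j) j := by
  simp only [map_sum, dC]
  rw [Finset.mul_sum, Finset.mul_sum, Finset.mul_sum, ← Finset.sum_add_distrib]
  refine Finset.sum_congr rfl fun j _ => ?_
  rcases lt_or_ge m (2 * j) with h | h
  · simp [hc0 j h]
  · have := euler_EE (m - 2 * j) j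
    rw [Nat.cast_sub h] at this
    push_cast at this
    rw [sub_add_cancel] at this
    linear_combination C (c j) * this

lemma Dop_mul (k : ℝ) (l : ℕ) (N L : ℝ) (g : MvPolynomial (Fin 2) ℝ)
    (hE : X 0 * pderiv 0 g + 2 * X 1 * pderiv 1 g = C N * g) (hD : Dop k g = C L * g) :
    Dop k (X 1 ^ l * g) =
      C (L + 2 * l * N + 2 * l * (l - 1) + 2 * k * l) * (X 1 ^ l * g) := by
  unfold Dop at hD ⊢
  simp only [pderiv_mul, pderiv_pow, pderiv_X_self, p01, map_add] 
  apply MvPolynomial.funext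
  intro v
  have hE := congrArg (eval v) hE
  have hD := congrArg (eval v) hD
  rcases l with _ | _ | l <;>
  simp only [map_add, map_mul, map_sub, map_pow, eval_C, eval_X, map_ofNat, map_zero, map_one,
    map_natCast, pderiv_mul, pderiv_pow, pderiv_X_self, p01, Derivation.map_natCast, Derivation.map_one_eq_zero,
    Nat.cast_zero, Nat.cast_add, Nat.cast_one, zero_add, Nat.add_sub_cancel] at hE hD ⊢
  · linear_combination hD
  · simp
    linear_combination v 1 * hD + 2 * v 1 * hE
  · linear_combination v 1 ^ (l + 2) * hD + 2 * (l + 2) * v 1 ^ (l + 2) * hE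

lemma chain (g : MvPolynomial (Fin 2) ℝ) (σ ρ : ℝ → ℝ) (σ' ρ' t : ℝ) (hσ : HasDerivAt σ σ' t)
    (hρ : HasDerivAt ρ ρ' t) :
    HasDerivAt (fun t => eval ![σ t, ρ t] g)
      (σ' * eval ![σ t, ρ t] (pderiv 0 g) + ρ' * eval ![σ t, ρ t] (pderiv 1 g)) t := by
  induction g using MvPolynomial.induction_on with
  | C a => simpa using hasDerivAt_const t a
  | add p q hp hq =>
    simp only [map_add]
    exact (hp.add hq).congr_deriv (by ring)
  | mul_X p i hp =>
    simp only [map_mul, eval_X, pderiv_mul, map_add]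
    fin_cases i
    · simp only [Fin.zero_eta, Matrix.cons_val_zero, pderiv_X_self, p10, map_one, map_zero]
      exact (hp.mul hσ).congr_deriv (by ring)
    · simp only [Fin.mk_one, Matrix.cons_val_one, Matrix.cons_val_zero, pderiv_X_self, p01, map_one, map_zero]
      exact (hp.mul hρ).congr_deriv (by ring)

lemma cont_eval {Z : Type*} [TopologicalSpace Z] (g : MvPolynomial (Fin 2) ℝ) (σ ρ : Z → ℝ)
    (hσ : Continuous σ) (hρ : Continuous ρ) : Continuous (fun z => eval ![σ z, ρ z] g) := by
  refine (MvPolynomial.continuous_eval g).comp ?_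
  refine continuous_pi fun i => ?_
  fin_cases i
  · simpa using hσ
  · simpa using hρ

lemma pcomm (g : MvPolynomial (Fin 2) ℝ) :
    pderiv 0 (pderiv 1 g) = pderiv 1 (pderiv 0 g) := by
  induction g using MvPolynomial.induction_on with
  | C a => simp
  | add p q hp hq => simp only [map_add, hp, hq]
  | mul_X p i hp =>
    fin_cases i <;> simp [pderiv_mul, p01, p10, hp, add_comm]
end

lemma prod_bound (x₁ x₂ y₁ y₂ u : ℝ) (hx₁ : 0 < x₁) (hx₂ : 0 < x₂) (hy₁ : 0 < y₁) (hy₂ : 0 < y₂)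
    (h1 : -1 ≤ u) (h2 : u ≤ 1) :
    0 ≤ (alph x₁ x₂ y₁ y₂ u) ^ 2 - 4 * x₁ * x₂ * y₁ * y₂ := by
  have e : alph x₁ x₂ y₁ y₂ u = (1 + u) / 2 * (x₁ * y₁ + x₂ * y₂) + (1 - u) / 2 * (x₁ * y₂ + x₂ * y₁) := by
    unfold alph; ring
  set r := Real.sqrt (4 * x₁ * x₂ * y₁ * y₂) with hr
  have hr2 : r ^ 2 = 4 * x₁ * x₂ * y₁ * y₂ := Real.sq_sqrt (by positivity)
  have hA : r ≤ x₁ * y₁ + x₂ * y₂ := by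
    apply Real.sqrt_le_iff.2 ⟨by positivity, by nlinarith [sq_nonneg (x₁ * y₁ - x₂ * y₂)]⟩
  have hB : r ≤ x₁ * y₂ + x₂ * y₁ := by
    apply Real.sqrt_le_iff.2 ⟨by positivity, by nlinarith [sq_nonneg (x₁ * y₂ - x₂ * y₁)]⟩
  have : r ≤ alph x₁ x₂ y₁ y₂ u := by
    rw [e]
    have := mul_le_mul_of_nonneg_left hA (show 0 ≤ (1 + u) / 2 by linarith)
    have := mul_le_mul_of_nonneg_left hB (show 0 ≤ (1 - u) / 2 by linarith)
    linarith
  have hr0 : 0 ≤ r := Real.sqrt_nonneg _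
  rw [← hr2]; nlinarith

open MvPolynomial in
lemma jack_poly (k : ℝ) (hk : 0 < k) (m ℓ : ℕ) : ∃ g : MvPolynomial (Fin 2) ℝ,
    (∀ x₁ x₂, JackP k m ℓ x₁ x₂ = eval ![x₁ + x₂, x₁ * x₂] g) ∧
    Dop k g = C (((m : ℝ) + ℓ) * ((m : ℝ) + ℓ + 2 * k - 1) + (ℓ : ℝ) * ((ℓ : ℝ) - 1)) * g := by
  refine ⟨C ((Real.Gamma (m + 2 * k) / ((2 : ℝ) ^ (2 * k - 1) * Real.Gamma k * Real.Gamma (m + k)))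
    * (1 / 2) ^ m) * (X 1 ^ ℓ * ∑ j ∈ Finset.range (m + 1), C (cc k m j) * EE (m - 2 * j) j), ?_, ?_⟩
  · intro x₁ x₂
    unfold JackP
    rw [jack_int k hk]
    simp only [EE, map_mul, eval_C, eval_X, map_pow, map_sum, map_sub, map_ofNat,
      Matrix.cons_val_zero, Matrix.cons_val_one]
    ring
  · rw [Dop_C, Dop_mul k ℓ _ _ _ (euler_G m _ (cc_zero k m))
      (Dop_G k m _ (cc_zero k m) (cc_rec k hk m))]
    rw [show (((m : ℝ) + ℓ) * ((m : ℝ) + ℓ + 2 * k - 1) + (ℓ : ℝ) * ((ℓ : ℝ) - 1)) =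
      (m : ℝ) * (m - 1 + 2 * k) + 2 * ℓ * m + 2 * ℓ * (ℓ - 1) + 2 * k * ℓ by ring]
    ring

theorem H_is_eigenfunction_of_LaplaceBeltrami
    (k : ℝ) (hk : 0 < k) (m ℓ : ℕ)
    (y₁ y₂ : ℝ) (hy₁ : 0 < y₁) (hy₂ : 0 < y₂) (hy : y₁ ≠ y₂)
    (H : ℝ → ℝ → ℝ)
    (hH : ∀ x₁ x₂ : ℝ, H x₁ x₂ =
      (Real.Gamma (k + 1 / 2) / (Real.Gamma k * Real.sqrt Real.pi)) *
        ∫ u in (-1 : ℝ)..1,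
          JackP k m ℓ (X1 x₁ x₂ y₁ y₂ u) (X2 x₁ x₂ y₁ y₂ u) * (1 - u ^ 2) ^ (k - 1))
    (x₁ x₂ : ℝ) (hx₁ : 0 < x₁) (hx₂ : 0 < x₂) (hne : x₁ ≠ x₂) :
    Lam k H x₁ x₂ =
      (((m : ℝ) + ℓ) * ((m : ℝ) + ℓ + 2 * k - 1) + (ℓ : ℝ) * ((ℓ : ℝ) - 1)) * H x₁ x₂ := by
  obtain ⟨g, hg, hD⟩ := jack_poly k hk m ℓ
  set e := (((m : ℝ) + ℓ) * ((m : ℝ) + ℓ + 2 * k - 1) + (ℓ : ℝ) * ((ℓ : ℝ) - 1)) with he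
  set K := (Real.Gamma (k + 1 / 2) / (Real.Gamma k * Real.sqrt Real.pi)) with hK
  set w : ℝ → ℝ := fun u => (1 - u ^ 2) ^ (k - 1) with hw
  have hwi : IntervalIntegrable w MeasureTheory.volume (-1) 1 := w_intble k hk
  let V : ℝ → ℝ → ℝ → Fin 2 → ℝ := fun s t u => ![alph s t y₁ y₂ u, s * t * (y₁ * y₂)]
  let ev : MvPolynomial (Fin 2) ℝ → ℝ → ℝ → ℝ → ℝ := fun p s t u => MvPolynomial.eval (V s t u) p
  let gs := MvPolynomial.pderiv 0 g
  let gp := MvPolynomial.pderiv 1 g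
  let gss := MvPolynomial.pderiv 0 gs
  let gsp := MvPolynomial.pderiv 1 gs
  let gpp := MvPolynomial.pderiv 1 gp
  have hps : MvPolynomial.pderiv 0 gp = gsp := pcomm g
  let a : ℝ → ℝ := fun u => ((y₁ + y₂) + (y₁ - y₂) * u) / 2
  let b : ℝ → ℝ := fun u => ((y₁ + y₂) - (y₁ - y₂) * u) / 2
  have hHG : ∀ s t : ℝ, 0 < s → 0 < t → H s t = K * ∫ u in (-1 : ℝ)..1, ev g s t u * w u := by
    intro s t hs ht
    rw [hH]
    congr 1
    apply intervalIntegral.integral_congr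
    intro u hu
    rw [Set.uIcc_of_le (by norm_num)] at hu
    simp only [hg, ev, V]
    have h0 := prod_bound s t y₁ y₂ u hs ht hy₁ hy₂ hu.1 hu.2
    have h1 : X1 s t y₁ y₂ u + X2 s t y₁ y₂ u = alph s t y₁ y₂ u := by unfold X1 X2; ring
    have h2 : X1 s t y₁ y₂ u * X2 s t y₁ y₂ u = s * t * (y₁ * y₂) := by
      have := Real.sq_sqrt h0
      unfold X1 X2
      linear_combination (-1 / 4) * this
    rw [h1, h2]
  have ca : Continuous a := by fun_prop
  have cb : Continuous b := by fun_prop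
  have cev1 : ∀ p t, Continuous (fun z : ℝ × ℝ => ev p z.1 t z.2) := fun p t =>
    cont_eval p _ _ (by unfold alph; fun_prop) (by fun_prop)
  have cev2 : ∀ p s, Continuous (fun z : ℝ × ℝ => ev p s z.1 z.2) := fun p t =>
    cont_eval p _ _ (by unfold alph; fun_prop) (by fun_prop)
  have cev : ∀ p s t, Continuous (fun u : ℝ => ev p s t u) := fun p s t =>
    cont_eval p _ _ (by unfold alph; fun_prop) (by fun_prop)
  have d1 : ∀ p s t u, HasDerivAt (fun s => ev p s t u)
      (a u * ev (MvPolynomial.pderiv 0 p) s t u + t * (y₁ * y₂) * ev (MvPolynomial.pderiv 1 p) s t u) s := by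
    intro p s t u
    refine chain p _ _ _ _ s ?_ ?_
    · have : (fun s => alph s t y₁ y₂ u) = fun s => s * a u + t * b u := by
        funext s; simp only [alph, a, b]; ring
      rw [this]
      simpa using ((hasDerivAt_id s).mul_const (a u)).add_const (t * b u)
    · simpa [mul_assoc] using (hasDerivAt_id s).mul_const (t * (y₁ * y₂))
  have d2 : ∀ p s t u, HasDerivAt (fun t => ev p s t u)
      (b u * ev (MvPolynomial.pderiv 0 p) s t u + s * (y₁ * y₂) * ev (MvPolynomial.pderiv 1 p) s t u) t := by
    intro p s t u
    refine chain p _ _ _ _ t ?_ ?_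
    · have : (fun t => alph s t y₁ y₂ u) = fun t => t * b u + s * a u := by
        funext t; simp only [alph, a, b]; ring
      rw [this]
      simpa using ((hasDerivAt_id t).mul_const (b u)).add_const (s * a u)
    · have := ((hasDerivAt_id t).mul_const (s * (y₁ * y₂)))
      simp only [id, one_mul] at this
      refine this.congr_of_eventuallyEq (Filter.Eventually.of_forall fun t => ?_)
      simp only; ring
  have d3 : ∀ p s t u, HasDerivAt (fun u => ev p s t u)
      ((s - t) * (y₁ - y₂) / 2 * ev (MvPolynomial.pderiv 0 p) s t u) u := by
    intro p s t u
    have := chain p (fun u => alph s t y₁ y₂ u) (fun _ => s * t * (y₁ * y₂))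
      ((s - t) * (y₁ - y₂) / 2) 0 u ?_ (hasDerivAt_const _ _)
    · refine this.congr_deriv ?_
      simp [ev, V]
    · have : (fun u => alph s t y₁ y₂ u) = fun u => u * ((s - t) * (y₁ - y₂) / 2) +
          (s + t) * (y₁ + y₂) / 2 := by
        funext u; simp only [alph]; ring
      rw [this]
      simpa using ((hasDerivAt_id u).mul_const ((s - t) * (y₁ - y₂) / 2)).add_const
        ((s + t) * (y₁ + y₂) / 2)
  let A1 : ℝ → ℝ → ℝ → ℝ := fun s t u => a u * ev gs s t u + t * (y₁ * y₂) * ev gp s t u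
  let A2 : ℝ → ℝ → ℝ → ℝ := fun s t u => b u * ev gs s t u + s * (y₁ * y₂) * ev gp s t u
  let A11 : ℝ → ℝ → ℝ → ℝ := fun s t u =>
    a u * (a u * ev gss s t u + t * (y₁ * y₂) * ev gsp s t u)
      + t * (y₁ * y₂) * (a u * ev gsp s t u + t * (y₁ * y₂) * ev gpp s t u)
  let A22 : ℝ → ℝ → ℝ → ℝ := fun s t u =>
    b u * (b u * ev gss s t u + s * (y₁ * y₂) * ev gsp s t u)
      + s * (y₁ * y₂) * (b u * ev gsp s t u + s * (y₁ * y₂) * ev gpp s t u)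
  have c1 : ∀ t, Continuous (fun z : ℝ × ℝ => A1 z.1 t z.2) := fun t =>
    ((ca.comp continuous_snd).mul (cev1 gs t)).add (continuous_const.mul (cev1 gp t))
  have c2 : ∀ s, Continuous (fun z : ℝ × ℝ => A2 s z.1 z.2) := fun s =>
    ((cb.comp continuous_snd).mul (cev2 gs s)).add (continuous_const.mul (cev2 gp s))
  have c11 : ∀ t, Continuous (fun z : ℝ × ℝ => A11 z.1 t z.2) := fun t =>
    ((ca.comp continuous_snd).mul (((ca.comp continuous_snd).mul (cev1 gss t)).add
      (continuous_const.mul (cev1 gsp t)))).add (continuous_const.mul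
      (((ca.comp continuous_snd).mul (cev1 gsp t)).add (continuous_const.mul (cev1 gpp t))))
  have c22 : ∀ s, Continuous (fun z : ℝ × ℝ => A22 s z.1 z.2) := fun s =>
    ((cb.comp continuous_snd).mul (((cb.comp continuous_snd).mul (cev2 gss s)).add
      (continuous_const.mul (cev2 gsp s)))).add (continuous_const.mul
      (((cb.comp continuous_snd).mul (cev2 gsp s)).add (continuous_const.mul (cev2 gpp s))))
  have D1 : ∀ s t, HasDerivAt (fun s => K * ∫ u in (-1 : ℝ)..1, ev g s t u * w u)
      (K * ∫ u in (-1 : ℝ)..1, A1 s t u * w u) s := fun s t =>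
    (deriv_under w hwi (fun s u => ev g s t u) (fun s u => A1 s t u) (fun s u => d1 g s t u)
      (cev1 g t) (c1 t) s).const_mul K
  have D2 : ∀ s t, HasDerivAt (fun t => K * ∫ u in (-1 : ℝ)..1, ev g s t u * w u)
      (K * ∫ u in (-1 : ℝ)..1, A2 s t u * w u) t := fun s t =>
    (deriv_under w hwi (fun t u => ev g s t u) (fun t u => A2 s t u) (fun t u => d2 g s t u)
      (cev2 g s) (c2 s) t).const_mul K
  have D11 : ∀ s t, HasDerivAt (fun s => K * ∫ u in (-1 : ℝ)..1, A1 s t u * w u)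
      (K * ∫ u in (-1 : ℝ)..1, A11 s t u * w u) s := fun s t =>
    (deriv_under w hwi (fun s u => A1 s t u) (fun s u => A11 s t u) (fun s u => by
      have h1 := ((d1 gs s t u).const_mul (a u)).add ((d1 gp s t u).const_mul (t * (y₁ * y₂)))
      rw [hps] at h1
      exact h1) (c1 t) (c11 t) s).const_mul K
  have D22 : ∀ s t, HasDerivAt (fun t => K * ∫ u in (-1 : ℝ)..1, A2 s t u * w u)
      (K * ∫ u in (-1 : ℝ)..1, A22 s t u * w u) t := fun s t =>
    (deriv_under w hwi (fun t u => A2 s t u) (fun t u => A22 s t u) (fun t u => by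
      have h1 := ((d2 gs s t u).const_mul (b u)).add ((d2 gp s t u).const_mul (s * (y₁ * y₂)))
      rw [hps] at h1
      exact h1) (c2 s) (c22 s) t).const_mul K
  have ev1 : (fun s => H s x₂) =ᶠ[nhds x₁] fun s => K * ∫ u in (-1 : ℝ)..1, ev g s x₂ u * w u := by
    filter_upwards [lt_mem_nhds hx₁] with s hs using hHG s x₂ hs hx₂
  have ev2 : (fun t => H x₁ t) =ᶠ[nhds x₂] fun t => K * ∫ u in (-1 : ℝ)..1, ev g x₁ t u * w u := by
    filter_upwards [lt_mem_nhds hx₂] with t ht using hHG x₁ t hx₁ ht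
  have r1 : deriv (fun s => H s x₂) x₁ = K * ∫ u in (-1 : ℝ)..1, A1 x₁ x₂ u * w u :=
    ev1.deriv_eq.trans (D1 x₁ x₂).deriv
  have r2 : deriv (fun t => H x₁ t) x₂ = K * ∫ u in (-1 : ℝ)..1, A2 x₁ x₂ u * w u :=
    ev2.deriv_eq.trans (D2 x₁ x₂).deriv
  have r11 : deriv (deriv (fun s => H s x₂)) x₁ = K * ∫ u in (-1 : ℝ)..1, A11 x₁ x₂ u * w u := by
    rw [ev1.deriv.deriv_eq, show deriv (fun s => K * ∫ u in (-1 : ℝ)..1, ev g s x₂ u * w u) =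
      fun s => K * ∫ u in (-1 : ℝ)..1, A1 s x₂ u * w u from funext fun s => (D1 s x₂).deriv]
    exact (D11 x₁ x₂).deriv
  have r22 : deriv (deriv (fun t => H x₁ t)) x₂ = K * ∫ u in (-1 : ℝ)..1, A22 x₁ x₂ u * w u := by
    rw [ev2.deriv.deriv_eq, show deriv (fun t => K * ∫ u in (-1 : ℝ)..1, ev g x₁ t u * w u) =
      fun t => K * ∫ u in (-1 : ℝ)..1, A2 x₁ t u * w u from funext fun t => (D2 x₁ t).deriv]
    exact (D22 x₁ x₂).deriv
  unfold Lam
  rw [r1, r2, r11, r22, hHG x₁ x₂ hx₁ hx₂]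
  have hT := total_deriv k hk (fun u => ev gs x₁ x₂ u)
    (fun u => (x₁ - x₂) * (y₁ - y₂) / 2 * ev gss x₁ x₂ u) (fun u => d3 gs x₁ x₂ u)
    (continuous_const.mul (cev gss x₁ x₂))
  have ii : ∀ f : ℝ → ℝ, Continuous f →
      IntervalIntegrable (fun u => f u * w u) MeasureTheory.volume (-1) 1 :=
    fun f hf => hwi.continuousOn_mul hf.continuousOn
  have cu : Continuous (fun u : ℝ => (x₁, u)) := by fun_prop
  have cu2 : Continuous (fun u : ℝ => (x₂, u)) := by fun_prop
  have i1 := ii (A1 x₁ x₂) ((c1 x₂).comp cu)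
  have i2 := ii (A2 x₁ x₂) ((c2 x₁).comp cu2)
  have i11 := ii (A11 x₁ x₂) ((c11 x₂).comp cu)
  have i22 := ii (A22 x₁ x₂) ((c22 x₁).comp cu2)
  have i0 := ii (ev g x₁ x₂) (cev g x₁ x₂)
  have hd : x₁ - x₂ ≠ 0 := sub_ne_zero.2 hne
  have hd' : x₂ - x₁ ≠ 0 := sub_ne_zero.2 hne.symm
  have point : ∀ u, x₁ ^ 2 * (A11 x₁ x₂ u * w u) + x₂ ^ 2 * (A22 x₁ x₂ u * w u) +
      2 * k * (x₁ ^ 2 / (x₁ - x₂)) * (A1 x₁ x₂ u * w u) +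
      2 * k * (x₂ ^ 2 / (x₂ - x₁)) * (A2 x₁ x₂ u * w u) - e * (ev g x₁ x₂ u * w u) =
      -(x₁ * x₂ * (y₁ - y₂) / (x₁ - x₂)) * (((1 - u ^ 2) * ((x₁ - x₂) * (y₁ - y₂) / 2 *
        ev gss x₁ x₂ u) - 2 * k * u * ev gs x₁ x₂ u) * (1 - u ^ 2) ^ (k - 1)) := by
    intro u
    have hDu := congrArg (MvPolynomial.eval (V x₁ x₂ u)) hD
    unfold Dop at hDu
    simp only [map_add, map_mul, map_sub, map_pow, MvPolynomial.eval_C, MvPolynomial.eval_X,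
      map_ofNat] at hDu
    have v0 : V x₁ x₂ u 0 = alph x₁ x₂ y₁ y₂ u := rfl
    have v1 : V x₁ x₂ u 1 = x₁ * x₂ * (y₁ * y₂) := rfl
    rw [v0, v1] at hDu
    change (alph x₁ x₂ y₁ y₂ u ^ 2 - 2 * (x₁ * x₂ * (y₁ * y₂))) * ev gss x₁ x₂ u +
      2 * (x₁ * x₂ * (y₁ * y₂)) * alph x₁ x₂ y₁ y₂ u * ev gsp x₁ x₂ u +
      2 * (x₁ * x₂ * (y₁ * y₂)) ^ 2 * ev gpp x₁ x₂ u +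
      2 * k * (alph x₁ x₂ y₁ y₂ u * ev gs x₁ x₂ u + x₁ * x₂ * (y₁ * y₂) * ev gp x₁ x₂ u) =
      e * ev g x₁ x₂ u at hDu
    change _ = -(x₁ * x₂ * (y₁ - y₂) / (x₁ - x₂)) * (((1 - u ^ 2) * ((x₁ - x₂) * (y₁ - y₂) / 2 *
        ev gss x₁ x₂ u) - 2 * k * u * ev gs x₁ x₂ u) * w u)
    rw [show x₂ - x₁ = -(x₁ - x₂) by ring]
    rw [show e * (ev g x₁ x₂ u * w u) = (e * ev g x₁ x₂ u) * w u by ring, ← hDu]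
    simp only [A1, A2, A11, A22, a, b, alph]
    generalize ev gss x₁ x₂ u = z1
    generalize ev gs x₁ x₂ u = z2
    generalize ev gsp x₁ x₂ u = z3
    generalize ev gp x₁ x₂ u = z4
    generalize ev gpp x₁ x₂ u = z5
    generalize w u = ω
    field_simp
    ring
  have hint : ∫ u in (-1 : ℝ)..1, (x₁ ^ 2 * (A11 x₁ x₂ u * w u) + x₂ ^ 2 * (A22 x₁ x₂ u * w u) +
      2 * k * (x₁ ^ 2 / (x₁ - x₂)) * (A1 x₁ x₂ u * w u) +
      2 * k * (x₂ ^ 2 / (x₂ - x₁)) * (A2 x₁ x₂ u * w u) - e * (ev g x₁ x₂ u * w u)) = 0 := by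
    simp only [point]
    rw [intervalIntegral.integral_const_mul, hT, mul_zero]
  rw [intervalIntegral.integral_sub ((((i11.const_mul _).add (i22.const_mul _)).add
      (i1.const_mul _)).add (i2.const_mul _)) (i0.const_mul _),
    intervalIntegral.integral_add (((i11.const_mul _).add (i22.const_mul _)).add
      (i1.const_mul _)) (i2.const_mul _),
    intervalIntegral.integral_add ((i11.const_mul _).add (i22.const_mul _)) (i1.const_mul _),
    intervalIntegral.integral_add (i11.const_mul _) (i22.const_mul _)] at hint
  simp only [intervalIntegral.integral_const_mul] at hint
  linear_combination K * hint
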